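/- arXiv:1308.2859 — 2 statements merged into one kernel-verified Lean document; each statement's English description precedes it below -/
import Mathlib

section
/- For 0 < q < 1 and 0 < a < q^{-1}, the Wall polynomials satisfy the dual orthogonality relations Σ_{n=0}^∞ ((aq;q)_n / ((aq)^n (q;q)_n)) p_n(q^k;a;q) p_n(q^l;a;q) = δ_{kl} (aq)^{-k} (q;q)_k / (aq;q)_∞ for k, l ∈ ℕ. -/
/-- The finite q-shifted factorial `(a;q)_k`. -/
noncomputable def qp (q a : ℝ) (k : ℕ) : ℝ := ∏ i ∈ Finset.range k, (1 - a * q ^ i)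

/-- The infinite q-shifted factorial `(a;q)_∞`. -/
noncomputable def qpInf (q a : ℝ) : ℝ := ∏' i : ℕ, (1 - a * q ^ i)

/-- The Wall polynomial `p_n(x;a;q) = ₂φ₁(q^{-n},0;aq;q,qx)` as a terminating sum. -/
noncomputable def wall (n : ℕ) (x a q : ℝ) : ℝ :=
  ∑ j ∈ Finset.range (n + 1), qp q (q ^ (-(n : ℤ))) j / (qp q (a * q) j * qp q q j) * (q * x) ^ j

open Filter Topology

/-! ### Finite q-shifted factorials -/

@[simp] lemma qp_zero (q a : ℝ) : qp q a 0 = 1 := by simp [qp]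

lemma qp_succ (q a : ℝ) (k : ℕ) : qp q a (k + 1) = qp q a k * (1 - a * q ^ k) := by
  simp [qp, Finset.prod_range_succ]

lemma qp_succ_left (q a : ℝ) (k : ℕ) : qp q a (k + 1) = (1 - a) * qp q (a * q) k := by
  simp only [qp, Finset.prod_range_succ', pow_zero, mul_one]
  rw [mul_comm]
  congr 1
  exact Finset.prod_congr rfl fun i _ => by ring

lemma one_sub_mul_pow_pos {q a : ℝ} (hq0 : 0 < q) (hq1 : q < 1) (ha0 : 0 < a) (ha1 : a < 1)
    (k : ℕ) : 0 < 1 - a * q ^ k := by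
  have := pow_le_one₀ (n := k) hq0.le hq1.le
  nlinarith [pow_pos hq0 k]

lemma qp_pos {q a : ℝ} (hq0 : 0 < q) (hq1 : q < 1) (ha0 : 0 < a) (ha1 : a < 1) (k : ℕ) :
    0 < qp q a k :=
  Finset.prod_pos fun i _ => one_sub_mul_pow_pos hq0 hq1 ha0 ha1 i

lemma qp_zpow_neg_eq_zero {q : ℝ} (hq0 : 0 < q) {n j : ℕ} (h : n < j) :
    qp q (q ^ (-(n : ℤ))) j = 0 := by
  refine Finset.prod_eq_zero (Finset.mem_range.2 h) ?_
  rw [zpow_neg, zpow_natCast, inv_mul_cancel₀ (pow_pos hq0 n).ne', sub_self]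

lemma tendsto_qp_qpInf {q a : ℝ} (hq0 : 0 < q) (hq1 : q < 1) :
    Tendsto (qp q a) atTop (𝓝 (qpInf q a)) := by
  have hs : Summable fun i : ℕ => ‖-(a * q ^ i)‖ := by
    simpa using ((summable_geometric_of_lt_one hq0.le hq1).mul_left |a|).congr
      fun i => by simp [abs_of_pos hq0]
  have hm : Multipliable fun i : ℕ => 1 - a * q ^ i := by
    simpa [sub_eq_add_neg] using multipliable_one_add_of_summable hs
  exact hm.hasProd.tendsto_prod_nat

/-! ### The coefficients of the Wall polynomials -/

/-- The coefficient of `x ^ j` in the Wall polynomial `p_n(x;a;q)`. -/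
noncomputable def wallCoeff (n : ℕ) (a q : ℝ) (j : ℕ) : ℝ :=
  qp q (q ^ (-(n : ℤ))) j / (qp q (a * q) j * qp q q j) * q ^ j

lemma wallCoeff_eq_zero {q : ℝ} (hq0 : 0 < q) (a : ℝ) {n j : ℕ} (h : n < j) :
    wallCoeff n a q j = 0 := by
  rw [wallCoeff, qp_zpow_neg_eq_zero hq0 h, zero_div, zero_mul]

lemma wall_eq_sum_range {q : ℝ} (hq0 : 0 < q) (a x : ℝ) {n N : ℕ} (h : n < N) :
    wall n x a q = ∑ j ∈ Finset.range N, wallCoeff n a q j * x ^ j := by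
  have h1 : wall n x a q = ∑ j ∈ Finset.range (n + 1), wallCoeff n a q j * x ^ j :=
    Finset.sum_congr rfl fun j _ => by rw [wallCoeff, mul_pow]; ring
  rw [h1]
  refine Finset.sum_subset (Finset.range_mono h) fun j _ hj => ?_
  rw [wallCoeff_eq_zero hq0 a (by simpa using hj), zero_mul]

lemma wallCoeff_succ {q a : ℝ} (hq0 : 0 < q) (hq1 : q < 1) (ha0 : 0 < a * q) (ha1 : a * q < 1)
    (n j : ℕ) :
    (1 - a * q ^ (j + 1)) * (1 - q ^ (j + 1)) * wallCoeff n a q (j + 1) =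
      q * (1 - q ^ (-(n : ℤ)) * q ^ j) * wallCoeff n a q j := by
  have h1 := (qp_pos hq0 hq1 ha0 ha1 j).ne'
  have h2 := (qp_pos hq0 hq1 hq0 hq1 j).ne'
  have h3 : 1 - a * q * q ^ j ≠ 0 := (one_sub_mul_pow_pos hq0 hq1 ha0 ha1 j).ne'
  have h4 : 1 - q * q ^ j ≠ 0 := (one_sub_mul_pow_pos hq0 hq1 hq0 hq1 j).ne'
  simp only [wallCoeff, qp_succ, pow_succ']
  rw [← mul_assoc a q]
  field_simp

/-- The q-difference equation of the Wall polynomials. -/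
lemma wall_qDifference {q a : ℝ} (hq0 : 0 < q) (hq1 : q < 1) (ha0 : 0 < a * q)
    (ha1 : a * q < 1) (n : ℕ) (x : ℝ) :
    wall n x a q - (1 + a) * wall n (q * x) a q + a * wall n (q ^ 2 * x) a q =
      q * x * (wall n x a q - q ^ (-(n : ℤ)) * wall n (q * x) a q) := by
  have hL : wall n x a q - (1 + a) * wall n (q * x) a q + a * wall n (q ^ 2 * x) a q =
      ∑ j ∈ Finset.range (n + 2),
        (1 - a * q ^ j) * (1 - q ^ j) * wallCoeff n a q j * x ^ j := by
    simp only [wall_eq_sum_range hq0 a _ (show n < n + 2 by omega), Finset.mul_sum,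
      ← Finset.sum_sub_distrib, ← Finset.sum_add_distrib]
    refine Finset.sum_congr rfl fun j _ => ?_
    simp only [mul_pow, ← pow_mul, mul_comm 2 j]
    ring
  have hR : q * x * (wall n x a q - q ^ (-(n : ℤ)) * wall n (q * x) a q) =
      ∑ j ∈ Finset.range (n + 1),
        q * (1 - q ^ (-(n : ℤ)) * q ^ j) * wallCoeff n a q j * x ^ (j + 1) := by
    simp only [wall_eq_sum_range hq0 a _ (show n < n + 1 by omega), Finset.mul_sum,
      ← Finset.sum_sub_distrib]
    refine Finset.sum_congr rfl fun j _ => ?_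
    simp only [mul_pow]
    ring
  rw [hL, hR, Finset.sum_range_succ']
  simp only [pow_zero, sub_self, mul_zero, zero_mul, add_zero]
  exact Finset.sum_congr rfl fun j _ => by rw [wallCoeff_succ hq0 hq1 ha0 ha1]

/-- The three-term recurrence in `k` satisfied by `p_n(q^k;a;q)`; at `k = 0` the coefficient of
the last term vanishes. -/
lemma wall_pow_succ {q a : ℝ} (hq0 : 0 < q) (hq1 : q < 1) (ha0 : 0 < a * q)
    (ha1 : a * q < 1) (n k : ℕ) :
    a * wall n (q ^ (k + 1)) a q =
      (1 + a) * wall n (q ^ k) a q - q ^ k * (q ^ (-(n : ℤ)) * wall n (q ^ k) a q)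
        - (1 - q ^ k) * wall n (q ^ (k - 1)) a q := by
  have hq := hq0.ne'
  rcases k with _ | k
  · have h := wall_qDifference hq0 hq1 ha0 ha1 n q⁻¹
    rw [mul_inv_cancel₀ hq, show q ^ 2 * q⁻¹ = q by field_simp] at h
    simp only [zero_add, pow_one, pow_zero]
    linear_combination h
  · have h := wall_qDifference hq0 hq1 ha0 ha1 n (q ^ k)
    rw [← pow_succ', ← pow_add, add_comm 2 k] at h
    simp only [Nat.add_sub_cancel]
    linear_combination h

lemma wall_succ_sub {q a : ℝ} (hq0 : 0 < q) (hq1 : q < 1) (ha0 : 0 < a * q)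
    (ha1 : a * q < 1) (n : ℕ) (x : ℝ) :
    wall (n + 1) x a q =
      wall n x a q - q ^ (-(n : ℤ)) * x / (1 - a * q) * wall n x (a * q) q := by
  have hc : ∀ j, wallCoeff (n + 1) a q (j + 1) = wallCoeff n a q (j + 1) -
      q ^ (-(n : ℤ)) / (1 - a * q) * wallCoeff n (a * q) q j := by
    intro j
    have ha' : a * q * q < 1 := by nlinarith
    have h1 := (qp_pos hq0 hq1 (mul_pos ha0 hq0) ha' j).ne'
    have h2 := (qp_pos hq0 hq1 hq0 hq1 j).ne'
    have h3 : 1 - a * q ≠ 0 := by linarith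
    have h4 : 1 - q * q ^ j ≠ 0 := (one_sub_mul_pow_pos hq0 hq1 hq0 hq1 j).ne'
    have hy : q ^ (-((n + 1 : ℕ) : ℤ)) * q = q ^ (-(n : ℤ)) := by
      rw [← zpow_add_one₀ hq0.ne']; congr 1; push_cast; ring
    simp only [wallCoeff]
    rw [qp_succ_left q (a * q), qp_succ q q, qp_succ_left q (q ^ (-((n + 1 : ℕ) : ℤ))), hy,
      qp_succ q (q ^ (-(n : ℤ))), ← hy]
    generalize q ^ (-((n + 1 : ℕ) : ℤ)) = y
    field_simp
    ring
  rw [wall_eq_sum_range hq0 a x (show n + 1 < n + 2 by omega),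
    wall_eq_sum_range hq0 a x (show n < n + 2 by omega),
    wall_eq_sum_range hq0 (a * q) x (show n < n + 1 by omega),
    Finset.sum_range_succ', Finset.sum_range_succ' _ (n + 1), Finset.mul_sum, add_sub_right_comm,
    ← Finset.sum_sub_distrib]
  congr 1
  exact Finset.sum_congr rfl fun j _ => by rw [hc]; ring

lemma pow_choose_two_succ (q : ℝ) (n : ℕ) :
    q ^ (n + 1).choose 2 = q ^ n.choose 2 * q ^ n := by
  rw [Nat.choose_succ_succ' n 1, Nat.choose_one_right, add_comm, pow_add]

/-- The value at `1`, a limiting case of the q-Chu–Vandermonde sum. -/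
lemma wall_one {q : ℝ} (hq0 : 0 < q) (hq1 : q < 1) (n : ℕ) :
    ∀ a : ℝ, 0 < a * q → a * q < 1 →
      wall n 1 a q = (-(a * q)) ^ n * q ^ n.choose 2 / qp q (a * q) n := by
  induction n with
  | zero => intro a _ _; simp [wall]
  | succ n ih =>
    intro a ha0 ha1
    have ha' : a * q * q < 1 := by nlinarith
    have h1 := (qp_pos hq0 hq1 (mul_pos ha0 hq0) ha' n).ne'
    have h2 := (qp_pos hq0 hq1 ha0 ha1 n).ne'
    have h3 : 1 - a * q ≠ 0 := by linarith
    have h4 : 1 - a * q * q ^ n ≠ 0 := (one_sub_mul_pow_pos hq0 hq1 ha0 ha1 n).ne'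
    have hq := hq0.ne'
    rw [wall_succ_sub hq0 hq1 ha0 ha1, ih a ha0 ha1, ih (a * q) (mul_pos ha0 hq0) ha']
    have h5 : qp q (a * q * q) n = qp q (a * q) n * (1 - a * q * q ^ n) / (1 - a * q) := by
      rw [eq_div_iff h3, mul_comm, ← qp_succ_left, qp_succ]
    rw [h5, qp_succ, pow_choose_two_succ, zpow_neg, zpow_natCast,
      show -(a * q * q) = -(a * q) * q by ring, mul_pow (-(a * q)) q n]
    field_simp
    ring

/-! ### Euler's and Cauchy's sums -/

/-- The general term of Euler's expansion of `(1;q)_∞`. -/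
noncomputable def eulerTerm (q : ℝ) (s : ℕ) : ℝ := (-1) ^ s * q ^ s.choose 2 / qp q q s

lemma eulerTerm_succ {q : ℝ} (hq0 : 0 < q) (hq1 : q < 1) (s : ℕ) :
    (1 - q ^ (s + 1)) * eulerTerm q (s + 1) = -(q ^ s * eulerTerm q s) := by
  have h2 := (qp_pos hq0 hq1 hq0 hq1 s).ne'
  have h4 : 1 - q * q ^ s ≠ 0 := (one_sub_mul_pow_pos hq0 hq1 hq0 hq1 s).ne'
  rw [eulerTerm, eulerTerm, qp_succ, pow_choose_two_succ, pow_succ' q]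
  field_simp
  ring

/-- The general term of Cauchy's series for `1 / (z;q)_∞`. -/
noncomputable def cauchyTerm (q z : ℝ) (s : ℕ) : ℝ :=
  z ^ s * (q ^ s.choose 2) ^ 2 / (qp q q s * qp q z s)

lemma cauchyTerm_pos {q z : ℝ} (hq0 : 0 < q) (hq1 : q < 1) (hz0 : 0 < z) (hz1 : z < 1) (s : ℕ) :
    0 < cauchyTerm q z s := by
  have := qp_pos hq0 hq1 hq0 hq1 s
  have := qp_pos hq0 hq1 hz0 hz1 s
  unfold cauchyTerm
  positivity

lemma cauchyTerm_succ {q z : ℝ} (s : ℕ) :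
    cauchyTerm q z (s + 1) =
      z * (q ^ s) ^ 2 / ((1 - q * q ^ s) * (1 - z * q ^ s)) * cauchyTerm q z s := by
  rw [cauchyTerm, cauchyTerm, qp_succ, qp_succ, pow_choose_two_succ, pow_succ' z, div_mul_div_comm]
  congr 1 <;> ring

lemma tendsto_one_sub_mul_pow {q : ℝ} (hq0 : 0 < q) (hq1 : q < 1) (z : ℝ) :
    Tendsto (fun s : ℕ => 1 - z * q ^ s) atTop (𝓝 1) := by
  simpa using ((tendsto_pow_atTop_nhds_zero_of_lt_one hq0.le hq1).const_mul z).const_sub 1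

lemma summable_cauchyTerm_mul_pow {q z : ℝ} (hq0 : 0 < q) (hq1 : q < 1) (hz0 : 0 < z)
    (hz1 : z < 1) (r : ℕ) :
    Summable fun s : ℕ => cauchyTerm q z s * (q ^ (-(s : ℤ))) ^ r := by
  have hpos : ∀ s : ℕ, 0 < cauchyTerm q z s * (q ^ (-(s : ℤ))) ^ r := fun s =>
    mul_pos (cauchyTerm_pos hq0 hq1 hz0 hz1 s) (pow_pos (zpow_pos hq0 _) r)
  refine summable_of_ratio_test_tendsto_lt_one (l := 0) one_pos
    (Eventually.of_forall fun s => (hpos s).ne') ?_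
  have hlim : Tendsto (fun s : ℕ =>
      z * (q ^ s) ^ 2 / ((1 - q * q ^ s) * (1 - z * q ^ s)) * (q⁻¹) ^ r) atTop (𝓝 0) := by
    have h := (((tendsto_pow_atTop_nhds_zero_of_lt_one hq0.le hq1).pow 2).const_mul z).div
      ((tendsto_one_sub_mul_pow hq0 hq1 q).mul (tendsto_one_sub_mul_pow hq0 hq1 z))
      (by norm_num)
    simpa [Pi.div_def] using h.mul_const ((q⁻¹) ^ r)
  refine hlim.congr fun s => ?_
  rw [Real.norm_of_nonneg (hpos _).le, Real.norm_of_nonneg (hpos _).le, eq_div_iff (hpos s).ne',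
    cauchyTerm_succ, show q ^ (-((s + 1 : ℕ) : ℤ)) = q⁻¹ * q ^ (-(s : ℤ)) by
      rw [← zpow_neg_one, ← zpow_add₀ hq0.ne']; congr 1; push_cast; ring, mul_pow]
  ring

lemma summable_cauchyTerm {q z : ℝ} (hq0 : 0 < q) (hq1 : q < 1) (hz0 : 0 < z) (hz1 : z < 1) :
    Summable (cauchyTerm q z) := by
  simpa using summable_cauchyTerm_mul_pow hq0 hq1 hz0 hz1 0

lemma summable_cauchyTerm_mul_eval {q z : ℝ} (hq0 : 0 < q) (hq1 : q < 1) (hz0 : 0 < z)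
    (hz1 : z < 1) (P : Polynomial ℝ) :
    Summable fun s : ℕ => cauchyTerm q z s * P.eval (q ^ (-(s : ℤ))) := by
  simp only [Polynomial.eval_eq_sum_range, Finset.mul_sum]
  refine summable_sum fun i _ => ?_
  exact ((summable_cauchyTerm_mul_pow hq0 hq1 hz0 hz1 i).mul_left (P.coeff i)).congr
    fun s => by ring

lemma sum_range_cauchyTerm {q z : ℝ} (hq0 : 0 < q) (hq1 : q < 1) (hz0 : 0 < z) (hz1 : z < 1)
    (N : ℕ) :
    ∑ s ∈ Finset.range N, ((1 - z) * cauchyTerm q z s - cauchyTerm q (z * q) s) =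
      -((1 - z) * (1 - q ^ N) * cauchyTerm q z N) := by
  induction N with
  | zero => simp
  | succ N ih =>
    have h1 := (qp_pos hq0 hq1 hz0 hz1 N).ne'
    have h2 := (qp_pos hq0 hq1 hq0 hq1 N).ne'
    have h3 : 1 - z ≠ 0 := by linarith
    have h4 : 1 - z * q ^ N ≠ 0 := (one_sub_mul_pow_pos hq0 hq1 hz0 hz1 N).ne'
    have h6 : 1 - q * q ^ N ≠ 0 := (one_sub_mul_pow_pos hq0 hq1 hq0 hq1 N).ne'
    have h5 : qp q (z * q) N = qp q z N * (1 - z * q ^ N) / (1 - z) := by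
      rw [eq_div_iff h3, mul_comm, ← qp_succ_left, qp_succ]
    have h7 : cauchyTerm q (z * q) N =
        q ^ N * (1 - z) / (1 - z * q ^ N) * cauchyTerm q z N := by
      rw [cauchyTerm, cauchyTerm, h5, mul_pow]
      field_simp
    rw [Finset.sum_range_succ, ih, cauchyTerm_succ, h7, pow_succ' q]
    generalize q ^ N = Q at *
    rw [mul_comm q Q] at h6 ⊢
    field_simp
    ring

lemma tsum_cauchyTerm_mul {q z : ℝ} (hq0 : 0 < q) (hq1 : q < 1) (hz0 : 0 < z) (hz1 : z < 1) :
    (1 - z) * ∑' s, cauchyTerm q z s = ∑' s, cauchyTerm q (z * q) s := by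
  have hzq : z * q < 1 := by nlinarith
  have hs := summable_cauchyTerm hq0 hq1 hz0 hz1
  have hs' := summable_cauchyTerm hq0 hq1 (mul_pos hz0 hq0) hzq
  have h1 := ((hs.hasSum.mul_left (1 - z)).sub hs'.hasSum).tendsto_sum_nat
  simp only [sum_range_cauchyTerm hq0 hq1 hz0 hz1] at h1
  have h2 : Tendsto (fun N : ℕ => -((1 - z) * (1 - q ^ N) * cauchyTerm q z N)) atTop (𝓝 0) := by
    simpa using ((((tendsto_one_sub_mul_pow hq0 hq1 1).const_mul (1 - z)).mul
      hs.tendsto_atTop_zero).neg)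
  exact sub_eq_zero.1 (tendsto_nhds_unique h1 h2)

/-- Cauchy's sum. -/
lemma tsum_cauchyTerm {q z : ℝ} (hq0 : 0 < q) (hq1 : q < 1) (hz0 : 0 < z) (hz1 : z < 1) :
    ∑' s, cauchyTerm q z s = 1 / qpInf q z := by
  have hzn0 : ∀ n : ℕ, 0 < z * q ^ n := fun n => mul_pos hz0 (pow_pos hq0 n)
  have hzn1 : ∀ n : ℕ, z * q ^ n < 1 := fun n => by
    linarith [one_sub_mul_pow_pos hq0 hq1 hz0 hz1 n]
  have hiter : ∀ n : ℕ, qp q z n * ∑' s, cauchyTerm q z s =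
      ∑' s, cauchyTerm q (z * q ^ n) s := by
    intro n
    induction n with
    | zero => simp
    | succ n ih =>
      rw [qp_succ, mul_right_comm, ih, mul_comm, tsum_cauchyTerm_mul hq0 hq1 (hzn0 n) (hzn1 n),
        pow_succ, mul_assoc]
  have hle : ∀ n s : ℕ, cauchyTerm q (z * q ^ n) (s + 1) ≤ q ^ n * cauchyTerm q z (s + 1) := by
    intro n s
    have hp : qp q z (s + 1) ≤ qp q (z * q ^ n) (s + 1) := by
      refine Finset.prod_le_prod
        (fun i _ => (one_sub_mul_pow_pos hq0 hq1 hz0 hz1 i).le) fun i _ => ?_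
      have := mul_le_of_le_one_right hz0.le (pow_le_one₀ (n := n) hq0.le hq1.le)
      gcongr
    have h1 := qp_pos hq0 hq1 hz0 hz1 (s + 1)
    have h2 := qp_pos hq0 hq1 hq0 hq1 (s + 1)
    have h3 : (z * q ^ n) ^ (s + 1) ≤ q ^ n * z ^ (s + 1) := by
      rw [mul_pow, mul_comm]
      gcongr
      exact pow_le_of_le_one (pow_pos hq0 n).le (pow_le_one₀ hq0.le hq1.le) (by omega)
    rw [cauchyTerm, cauchyTerm, ← mul_div_assoc, ← mul_assoc]
    gcongr
  have hlim : Tendsto (fun n : ℕ => ∑' s, cauchyTerm q (z * q ^ n) s) atTop (𝓝 1) := by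
    have hs := summable_cauchyTerm hq0 hq1 hz0 hz1
    have hsn := fun n => summable_cauchyTerm hq0 hq1 (hzn0 n) (hzn1 n)
    have hzero : ∀ w, cauchyTerm q w 0 = 1 := fun w => by simp [cauchyTerm]
    have hup : Tendsto (fun n : ℕ => 1 + q ^ n * ∑' s, cauchyTerm q z (s + 1)) atTop (𝓝 1) := by
      simpa using ((tendsto_pow_atTop_nhds_zero_of_lt_one hq0.le hq1).mul_const
        (∑' s, cauchyTerm q z (s + 1))).const_add 1
    refine tendsto_of_tendsto_of_tendsto_of_le_of_le tendsto_const_nhds hup ?_ ?_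
    · intro n
      simp only
      rw [(hsn n).tsum_eq_zero_add, hzero]
      have : 0 ≤ ∑' s, cauchyTerm q (z * q ^ n) (s + 1) :=
        tsum_nonneg fun s => (cauchyTerm_pos hq0 hq1 (hzn0 n) (hzn1 n) _).le
      linarith
    · intro n
      simp only [(hsn n).tsum_eq_zero_add, hzero, ← tsum_mul_left]
      gcongr
      · exact (summable_nat_add_iff 1).2 (hsn n)
      · exact ((summable_nat_add_iff 1).2 hs).mul_left _
      · exact hle n _
  have h := ((tendsto_qp_qpInf (a := z) hq0 hq1).mul_const (∑' s, cauchyTerm q z s))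
  simp only [hiter] at h
  have h1 := tendsto_nhds_unique h hlim
  rw [eq_div_iff (left_ne_zero_of_mul_eq_one h1), mul_comm, h1]

lemma summable_norm_eulerTerm {q : ℝ} (hq0 : 0 < q) (hq1 : q < 1) :
    Summable fun s => ‖eulerTerm q s‖ := by
  have hne : ∀ s, eulerTerm q s ≠ 0 := fun s => by
    have := (qp_pos hq0 hq1 hq0 hq1 s).ne'
    unfold eulerTerm
    positivity
  refine Summable.norm (summable_of_ratio_test_tendsto_lt_one (l := 0) one_pos
    (Eventually.of_forall hne) ?_)
  have hlim : Tendsto (fun s : ℕ => q ^ s / (1 - q * q ^ s)) atTop (𝓝 0) := by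
    simpa [Pi.div_def] using (tendsto_pow_atTop_nhds_zero_of_lt_one hq0.le hq1).div
      (tendsto_one_sub_mul_pow hq0 hq1 q) one_ne_zero
  refine hlim.congr fun s => ?_
  have h4 : 0 < 1 - q * q ^ s := one_sub_mul_pow_pos hq0 hq1 hq0 hq1 s
  have h := eulerTerm_succ hq0 hq1 s
  rw [pow_succ'] at h
  have h' := congrArg norm h
  rw [norm_neg, norm_mul, norm_mul, Real.norm_of_nonneg h4.le,
    Real.norm_of_nonneg (pow_pos hq0 s).le] at h'
  rw [eq_div_iff (norm_ne_zero_iff.2 (hne s)), div_mul_eq_mul_div, div_eq_iff h4.ne', ← h',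
    mul_comm]

lemma tsum_eulerTerm {q : ℝ} (hq0 : 0 < q) (hq1 : q < 1) : ∑' s, eulerTerm q s = 0 := by
  have hpart : ∀ N, ∑ s ∈ Finset.range N, eulerTerm q s =
      -((1 - q ^ N) * eulerTerm q N) := by
    intro N
    induction N with
    | zero => simp
    | succ N ih =>
      rw [Finset.sum_range_succ, ih, eulerTerm_succ hq0 hq1]
      ring
  have hs := (summable_norm_eulerTerm hq0 hq1).of_norm
  have h1 := hs.hasSum.tendsto_sum_nat
  simp only [hpart] at h1
  have h2 : Tendsto (fun N : ℕ => -((1 - q ^ N) * eulerTerm q N)) atTop (𝓝 0) := by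
    simpa using ((tendsto_one_sub_mul_pow hq0 hq1 1).mul hs.tendsto_atTop_zero).neg
  exact tendsto_nhds_unique h1 h2

/-! ### Dual orthogonality -/

lemma eulerTerm_mul_qp {q : ℝ} (hq0 : 0 < q) (hq1 : q < 1) (j : ℕ) : ∀ s : ℕ,
    eulerTerm q (j + s) * (qp q (q ^ (-((j + s : ℕ) : ℤ))) j * q ^ j) = eulerTerm q s := by
  induction j with
  | zero => intro s; simp
  | succ j ih =>
    intro s
    have hq := hq0.ne'
    have h := ih (s + 1)
    have he := eulerTerm_succ hq0 hq1 s
    rw [show j + 1 + s = j + (s + 1) by ring, qp_succ, pow_succ]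
    have hy : q ^ (-((j + (s + 1) : ℕ) : ℤ)) * q ^ j = (q ^ (s + 1))⁻¹ := by
      rw [← zpow_natCast q j, ← zpow_natCast q (s + 1), ← zpow_neg, ← zpow_add₀ hq]
      congr 1; push_cast; ring
    rw [hy]
    have hqs : q ^ s ≠ 0 := pow_ne_zero _ hq
    have hinv : (1 - (q ^ (s + 1))⁻¹) * q = -((1 - q ^ (s + 1)) / q ^ s) := by
      rw [pow_succ]; field_simp; ring
    calc _ = (eulerTerm q (j + (s + 1)) * (qp q (q ^ (-((j + (s + 1) : ℕ) : ℤ))) j * q ^ j)) *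
          ((1 - (q ^ (s + 1))⁻¹) * q) := by ring
      _ = eulerTerm q s := by
        rw [h, hinv]
        field_simp
        linear_combination -he

lemma tsum_eulerTerm_mul_wall {q a : ℝ} (hq0 : 0 < q) (hq1 : q < 1) (ha0 : 0 < a * q)
    (ha1 : a * q < 1) (k : ℕ) :
    ∑' n, eulerTerm q n * wall n (q ^ (k + 1)) a q = 0 := by
  set B : ℕ → ℝ := fun j => (q ^ (k + 1)) ^ j / (qp q (a * q) j * qp q q j) with hB
  have hBpos : ∀ j, 0 < B j := fun j => by
    have := qp_pos hq0 hq1 hq0 hq1 j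
    have := qp_pos hq0 hq1 ha0 ha1 j
    simp only [hB]
    positivity
  have hBs : Summable fun j => ‖B j‖ := by
    refine Summable.norm (summable_of_ratio_test_tendsto_lt_one (l := q ^ (k + 1))
      (pow_lt_one₀ hq0.le hq1 (by omega)) (Eventually.of_forall fun j => (hBpos j).ne') ?_)
    have hlim : Tendsto (fun j : ℕ => q ^ (k + 1) / ((1 - a * q * q ^ j) * (1 - q * q ^ j))) atTop
        (𝓝 (q ^ (k + 1))) := by
      simpa [Pi.div_def] using (tendsto_const_nhds (x := q ^ (k + 1))).div
        ((tendsto_one_sub_mul_pow hq0 hq1 (a * q)).mul (tendsto_one_sub_mul_pow hq0 hq1 q))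
        (by norm_num)
    refine hlim.congr fun j => ?_
    rw [Real.norm_of_nonneg (hBpos _).le, Real.norm_of_nonneg (hBpos _).le,
      eq_div_iff (hBpos j).ne']
    simp only [hB, qp_succ]
    rw [div_mul_div_comm, pow_succ' (q ^ (k + 1))]
    congr 1
    ring
  have hterm : ∀ n, eulerTerm q n * wall n (q ^ (k + 1)) a q =
      ∑ p ∈ Finset.HasAntidiagonal.antidiagonal n, B p.1 * eulerTerm q p.2 := by
    intro n
    rw [wall, Finset.mul_sum,
      Finset.Nat.sum_antidiagonal_eq_sum_range_succ (fun i j => B i * eulerTerm q j)]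
    refine Finset.sum_congr rfl fun j hj => ?_
    obtain ⟨s, rfl⟩ := Nat.exists_eq_add_of_le (Nat.lt_succ_iff.1 (Finset.mem_range.1 hj))
    rw [Nat.add_sub_cancel_left, ← eulerTerm_mul_qp hq0 hq1 j s, hB, mul_pow]
    ring
  simp only [hterm]
  rw [← tsum_mul_tsum_eq_tsum_sum_antidiagonal_of_summable_norm hBs
    (summable_norm_eulerTerm hq0 hq1), tsum_eulerTerm hq0 hq1, mul_zero]

lemma exists_polynomial_wall {q a : ℝ} (hq0 : 0 < q) (hq1 : q < 1) (ha0 : 0 < a * q)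
    (ha1 : a * q < 1) (k : ℕ) :
    ∃ P : Polynomial ℝ, ∀ n : ℕ,
      wall n (q ^ k) a q = wall n 1 a q * P.eval (q ^ (-(n : ℤ))) := by
  have ha : a ≠ 0 := left_ne_zero_of_mul ha0.ne'
  induction k using Nat.strong_induction_on with
  | _ k ih =>
    rcases k with _ | k
    · exact ⟨1, fun n => by simp⟩
    · obtain ⟨P, hP⟩ := ih k (by omega)
      obtain ⟨R, hR⟩ := ih (k - 1) (by omega)
      refine ⟨Polynomial.C a⁻¹ * (Polynomial.C (1 + a) * P -
        Polynomial.C (q ^ k) * (Polynomial.X * P) - Polynomial.C (1 - q ^ k) * R), fun n => ?_⟩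
      have h := wall_pow_succ hq0 hq1 ha0 ha1 n k
      rw [hP, hR] at h
      rw [← mul_right_inj' ha, h]
      simp only [Polynomial.eval_mul, Polynomial.eval_sub, Polynomial.eval_C, Polynomial.eval_X]
      field_simp

/-- The weight of the dual orthogonality relations. -/
noncomputable def wallWeight (a q : ℝ) (n : ℕ) : ℝ :=
  qp q (a * q) n / ((a * q) ^ n * qp q q n)

lemma wallWeight_mul_wall_one {q a : ℝ} (hq0 : 0 < q) (hq1 : q < 1) (ha0 : 0 < a * q)
    (ha1 : a * q < 1) (n : ℕ) : wallWeight a q n * wall n 1 a q = eulerTerm q n := by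
  have h1 := (qp_pos hq0 hq1 ha0 ha1 n).ne'
  have h2 := (qp_pos hq0 hq1 hq0 hq1 n).ne'
  have h3 := (pow_pos ha0 n).ne'
  rw [wall_one hq0 hq1 n a ha0 ha1, wallWeight, eulerTerm, neg_pow (a * q)]
  generalize (a * q) ^ n = c at *
  field_simp

lemma eulerTerm_mul_wall_one {q a : ℝ} (hq0 : 0 < q) (hq1 : q < 1) (ha0 : 0 < a * q)
    (ha1 : a * q < 1) (n : ℕ) : eulerTerm q n * wall n 1 a q = cauchyTerm q (a * q) n := by
  rw [wall_one hq0 hq1 n a ha0 ha1, cauchyTerm, eulerTerm, neg_pow (a * q), div_mul_div_comm]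
  congr 1
  have : ((-1 : ℝ) ^ n) * (-1) ^ n = 1 := by rw [← mul_pow]; simp
  linear_combination (a * q) ^ n * (q ^ n.choose 2) ^ 2 * this

lemma summable_wallWeight_mul {q a : ℝ} (hq0 : 0 < q) (hq1 : q < 1) (ha0 : 0 < a * q)
    (ha1 : a * q < 1) (k l r : ℕ) :
    Summable fun n : ℕ => wallWeight a q n * (q ^ (-(n : ℤ))) ^ r * wall n (q ^ k) a q *
      wall n (q ^ l) a q := by
  obtain ⟨P, hP⟩ := exists_polynomial_wall hq0 hq1 ha0 ha1 k
  obtain ⟨R, hR⟩ := exists_polynomial_wall hq0 hq1 ha0 ha1 l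
  refine (summable_cauchyTerm_mul_eval hq0 hq1 ha0 ha1 (Polynomial.X ^ r * P * R)).congr
    fun n => ?_
  rw [hP, hR, ← eulerTerm_mul_wall_one hq0 hq1 ha0 ha1, ← wallWeight_mul_wall_one hq0 hq1 ha0 ha1]
  simp only [Polynomial.eval_mul, Polynomial.eval_pow, Polynomial.eval_X]
  ring

/-- The series of the dual orthogonality relations. -/
noncomputable def wallDualSum (a q : ℝ) (k l : ℕ) : ℝ :=
  ∑' n : ℕ, wallWeight a q n * wall n (q ^ k) a q * wall n (q ^ l) a q

lemma wallDualSum_comm (a q : ℝ) (k l : ℕ) : wallDualSum a q k l = wallDualSum a q l k :=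
  tsum_congr fun _ => mul_right_comm _ _ _

lemma wallDualSum_succ_left {q a : ℝ} (hq0 : 0 < q) (hq1 : q < 1) (ha0 : 0 < a * q)
    (ha1 : a * q < 1) (k l : ℕ) :
    a * wallDualSum a q (k + 1) l =
      (1 + a) * wallDualSum a q k l - q ^ k * ∑' n : ℕ, wallWeight a q n * q ^ (-(n : ℤ)) *
        wall n (q ^ k) a q * wall n (q ^ l) a q - (1 - q ^ k) * wallDualSum a q (k - 1) l := by
  have hs : ∀ i, Summable fun n : ℕ => wallWeight a q n * wall n (q ^ i) a q *
      wall n (q ^ l) a q := fun i => by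
    simpa using summable_wallWeight_mul hq0 hq1 ha0 ha1 i l 0
  have hy : Summable fun n : ℕ => wallWeight a q n * q ^ (-(n : ℤ)) * wall n (q ^ k) a q *
      wall n (q ^ l) a q := by
    simpa using summable_wallWeight_mul hq0 hq1 ha0 ha1 k l 1
  have h := (((hs k).hasSum.mul_left (1 + a)).sub (hy.hasSum.mul_left (q ^ k))).sub
    ((hs (k - 1)).hasSum.mul_left (1 - q ^ k))
  refine ((hs (k + 1)).hasSum.mul_left a).unique (h.congr_fun fun n => ?_)
  linear_combination wallWeight a q n * wall n (q ^ l) a q * wall_pow_succ hq0 hq1 ha0 ha1 n k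

lemma wallDualSum_recurrence {q a : ℝ} (hq0 : 0 < q) (hq1 : q < 1) (ha0 : 0 < a * q)
    (ha1 : a * q < 1) (k l : ℕ) :
    q ^ l * (a * wallDualSum a q (k + 1) l - (1 + a) * wallDualSum a q k l +
        (1 - q ^ k) * wallDualSum a q (k - 1) l) =
      q ^ k * (a * wallDualSum a q k (l + 1) - (1 + a) * wallDualSum a q k l +
        (1 - q ^ l) * wallDualSum a q k (l - 1)) := by
  have h1 := wallDualSum_succ_left hq0 hq1 ha0 ha1 k l
  have h2 := wallDualSum_succ_left hq0 hq1 ha0 ha1 l k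
  have h3 : ∑' n : ℕ, wallWeight a q n * q ^ (-(n : ℤ)) * wall n (q ^ l) a q *
        wall n (q ^ k) a q = ∑' n : ℕ, wallWeight a q n * q ^ (-(n : ℤ)) *
        wall n (q ^ k) a q * wall n (q ^ l) a q := tsum_congr fun _ => mul_right_comm _ _ _
  rw [h3, wallDualSum_comm a q (l + 1), wallDualSum_comm a q l k,
    wallDualSum_comm a q (l - 1)] at h2
  linear_combination q ^ l * h1 - q ^ k * h2

lemma wallDualSum_zero_right {q a : ℝ} (hq0 : 0 < q) (hq1 : q < 1) (ha0 : 0 < a * q)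
    (ha1 : a * q < 1) (k : ℕ) :
    wallDualSum a q k 0 = if k = 0 then 1 / qpInf q (a * q) else 0 := by
  have h : wallDualSum a q k 0 = ∑' n, eulerTerm q n * wall n (q ^ k) a q :=
    tsum_congr fun n => by
      rw [pow_zero, mul_right_comm, wallWeight_mul_wall_one hq0 hq1 ha0 ha1]
  rw [h]
  rcases k with _ | k
  · simp only [pow_zero, eulerTerm_mul_wall_one hq0 hq1 ha0 ha1, if_true]
    exact tsum_cauchyTerm hq0 hq1 ha0 ha1
  · simpa using tsum_eulerTerm_mul_wall hq0 hq1 ha0 ha1 k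

/-- The recurrence `wallDualSum_recurrence` and the values at `l = 0` determine the solution. -/
lemma eq_ite_of_recurrence {q a : ℝ} (hq : q ≠ 0) (ha : a ≠ 0) {S : ℕ → ℕ → ℝ} {d : ℕ → ℝ}
    (hd : ∀ k, a * q * d (k + 1) = (1 - q ^ (k + 1)) * d k)
    (h0 : ∀ k, S k 0 = if k = 0 then d k else 0)
    (hS : ∀ k l, q ^ l * (a * S (k + 1) l - (1 + a) * S k l + (1 - q ^ k) * S (k - 1) l) =
      q ^ k * (a * S k (l + 1) - (1 + a) * S k l + (1 - q ^ l) * S k (l - 1)))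
    (l : ℕ) : ∀ k, S k l = if k = l then d k else 0 := by
  induction l using Nat.strong_induction_on with
  | _ l ih =>
    intro k
    rcases l with _ | l
    · exact h0 k
    · have h := hS k l
      have hl : (1 - q ^ l) * S k (l - 1) = if k + 1 = l then (1 - q ^ l) * d k else 0 := by
        rcases l with _ | l
        · simp
        · rw [Nat.add_sub_cancel, ih l (by omega)]
          by_cases hk : k = l <;> simp [hk]
      have hk : (1 - q ^ k) * S (k - 1) l = if k = l + 1 then (1 - q ^ k) * d l else 0 := by
        rcases k with _ | k
        · simp
        · rw [Nat.add_sub_cancel, ih l (by omega)]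
          by_cases hk : k = l <;> simp [hk]
      rw [hl, hk, ih l (by omega), ih l (by omega)] at h
      refine mul_left_cancel₀ (mul_ne_zero (pow_ne_zero k hq) ha) ?_
      rcases eq_or_ne k l with rfl | h1
      · simp only [left_eq_add, add_eq_left, one_ne_zero, if_true, if_false] at h ⊢
        linear_combination -h
      rcases eq_or_ne (k + 1) l with rfl | h2
      · simp only [if_true, if_neg h1, if_neg (show k ≠ k + 1 + 1 by omega)] at h ⊢
        linear_combination -h + q ^ k * hd k
      rcases eq_or_ne k (l + 1) with rfl | h3
      · simp only [if_true, if_neg h1, if_neg h2] at h ⊢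
        linear_combination -h - q ^ l * hd l
      simp only [if_neg h1, if_neg h2, if_neg h3] at h ⊢
      linear_combination -h

/-- dual orthogonality relations for the Wall polynomials. -/
theorem wall_dual_orthogonality (q a : ℝ) (hq0 : 0 < q) (hq1 : q < 1) (ha0 : 0 < a)
    (ha1 : a < q⁻¹) (k l : ℕ) :
    ∑' n : ℕ, qp q (a * q) n / ((a * q) ^ n * qp q q n) * wall n (q ^ k) a q *
        wall n (q ^ l) a q =
      (if k = l then (1 : ℝ) else 0) *
        ((a * q) ^ (-(k : ℤ)) * qp q q k / qpInf q (a * q)) := by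
  have haq : a * q < 1 := by rwa [← lt_div_iff₀ hq0, one_div]
  have haq0 := mul_pos ha0 hq0
  rw [zpow_neg, zpow_natCast, ite_mul, one_mul, zero_mul]
  refine eq_ite_of_recurrence (S := wallDualSum a q)
    (d := fun k => ((a * q) ^ k)⁻¹ * qp q q k / qpInf q (a * q)) hq0.ne' ha0.ne' (fun k => ?_)
    (fun k => ?_) (wallDualSum_recurrence hq0 hq1 haq0 haq) l k
  · have := hq0.ne'
    simp only [qp_succ, pow_succ', mul_inv]
    field_simp
  · rw [wallDualSum_zero_right hq0 hq1 haq0 haq]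
    by_cases hk : k = 0 <;> simp [hk]
end

section
/- For 0 < q < 1, ν ∈ ℂ with Re ν > -1, and z ∈ ℂ with |arg z| < π, Σ_{p=0}^∞ q^{2p} q^{pν} (q^{2+2p}; q²)_∞ J_ν(z q^p; q²) = z^ν (z² q²; q²)_∞. -/
/-- The finite q-shifted factorial `(a;q)_k` over `ℂ`. -/
noncomputable def qpC (q a : ℂ) (k : ℕ) : ℂ := ∏ i ∈ Finset.range k, (1 - a * q ^ i)

/-- The infinite q-shifted factorial `(a;q)_∞` over `ℂ`. -/
noncomputable def qpInfC (q a : ℂ) : ℂ := ∏' i : ℕ, (1 - a * q ^ i)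

/-- The Wall polynomial `p_n(x;a;q) = ₂φ₁(q^{-n},0;aq;q,qx)` over `ℂ`. -/
noncomputable def wallC (n : ℕ) (x a q : ℂ) : ℂ :=
  ∑ j ∈ Finset.range (n + 1),
    qpC q (q ^ (-(n : ℤ))) j / (qpC q (a * q) j * qpC q q j) * (q * x) ^ j
/-- The `₁φ₁` q-Bessel function `J_ν(x;q²)` of complex order `ν`, with `x^ν` the principal
branch, in the combined form
`x^ν (q²;q²)_∞⁻¹ Σ_k (-1)^k q^{k(k-1)} (q²x²)^k (q^{2ν+2+2k};q²)_∞ / (q²;q²)_k`. -/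
noncomputable def JC (q : ℝ) (ν x : ℂ) : ℂ :=
  x ^ ν * (∑' k : ℕ, (-1) ^ k * (q : ℂ) ^ (k * (k - 1)) * ((q : ℂ) ^ 2 * x ^ 2) ^ k *
      qpInfC ((q : ℂ) ^ 2) ((q : ℂ) ^ (2 * ν + 2 + 2 * (k : ℂ))) /
        qpC ((q : ℂ) ^ 2) ((q : ℂ) ^ 2) k) /
    qpInfC ((q : ℂ) ^ 2) ((q : ℂ) ^ 2)

open Filter Topology

section QSeries

variable {Q x : ℂ}

lemma multipliable_one_sub_mul_pow (hQ : ‖Q‖ < 1) (x : ℂ) :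
    Multipliable fun i : ℕ ↦ 1 - x * Q ^ i := by
  simp_rw [sub_eq_add_neg]
  refine multipliable_one_add_of_summable ?_
  simp only [norm_neg, norm_mul, norm_pow]
  exact (summable_geometric_of_lt_one (norm_nonneg _) hQ).mul_left _

lemma tendsto_qpC (hQ : ‖Q‖ < 1) (x : ℂ) :
    Tendsto (qpC Q x) atTop (𝓝 (qpInfC Q x)) :=
  (multipliable_one_sub_mul_pow hQ x).hasProd.tendsto_prod_nat

lemma qpC_succ (Q x : ℂ) (n : ℕ) : qpC Q x (n + 1) = qpC Q x n * (1 - x * Q ^ n) :=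
  Finset.prod_range_succ _ _

lemma qpC_mul_qpInfC (hQ : ‖Q‖ < 1) (x : ℂ) (n : ℕ) :
    qpC Q x n * qpInfC Q (x * Q ^ n) = qpInfC Q x := by
  have h : ∀ m, qpC Q x n * qpC Q (x * Q ^ n) m = qpC Q x (m + n) := by
    intro m
    rw [add_comm m n]
    simp only [qpC, Finset.prod_range_add]
    congr 1
    exact Finset.prod_congr rfl fun i _ ↦ by ring
  refine tendsto_nhds_unique (((tendsto_qpC hQ (x * Q ^ n)).const_mul _).congr h) ?_
  exact (tendsto_add_atTop_iff_nat n).2 (tendsto_qpC hQ x)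

lemma one_sub_pow_succ_ne_zero (hQ : ‖Q‖ < 1) (n : ℕ) : 1 - Q * Q ^ n ≠ 0 := by
  intro h
  have h1 : ‖Q ^ (n + 1)‖ < 1 := by
    rw [norm_pow]
    exact pow_lt_one₀ (norm_nonneg _) hQ (by simp)
  rw [pow_succ', ← sub_eq_zero.1 h, norm_one] at h1
  exact lt_irrefl _ h1

lemma qpC_self_ne_zero (hQ : ‖Q‖ < 1) (n : ℕ) : qpC Q Q n ≠ 0 :=
  Finset.prod_ne_zero_iff.2 fun i _ ↦ one_sub_pow_succ_ne_zero hQ i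

lemma tendsto_one_sub_pow_succ_inv (hQ : ‖Q‖ < 1) :
    Tendsto (fun n : ℕ ↦ (1 - Q * Q ^ n)⁻¹) atTop (𝓝 1) := by
  have h := ((tendsto_pow_atTop_nhds_zero_of_norm_lt_one hQ).const_mul Q).const_sub 1
  simpa using h.inv₀ (by simp)

/-- A series whose consecutive terms have ratio tending to a limit of norm `< 1` is absolutely
summable; the terms may vanish. -/
lemma summable_norm_of_succ_eq_mul {f ρ : ℕ → ℂ} {l : ℂ} (hl : ‖l‖ < 1)
    (hρ : Tendsto ρ atTop (𝓝 l)) (h : ∀ n, f (n + 1) = f n * ρ n) : Summable fun n ↦ ‖f n‖ := by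
  obtain ⟨r, hlr, hr⟩ := exists_between hl
  refine summable_of_ratio_norm_eventually_le hr ?_
  filter_upwards [hρ.norm.eventually_lt_const hlr] with n hn
  rw [norm_norm, norm_norm, h, norm_mul, mul_comm]
  gcongr

/-- A power series evaluated along `x * Q ^ n` tends to its constant coefficient. -/
lemma tendsto_tsum_mul_pow {c : ℕ → ℂ} (hQ : ‖Q‖ < 1) (hc : Summable fun k ↦ ‖c k * x ^ k‖) :
    Tendsto (fun n : ℕ ↦ ∑' k, c k * (x * Q ^ n) ^ k) atTop (𝓝 (c 0)) := by
  have h0 : ∑' k, (if k = 0 then c 0 else 0) = c 0 := tsum_ite_eq 0 _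
  rw [← h0]
  refine tendsto_tsum_of_dominated_convergence hc (fun k ↦ ?_) (.of_forall fun n k ↦ ?_)
  · have h := (((tendsto_pow_atTop_nhds_zero_of_norm_lt_one hQ).const_mul x).pow k).const_mul (c k)
    rcases eq_or_ne k 0 with rfl | hk
    · simp
    · simpa [hk] using h
  · rw [mul_pow, ← mul_assoc, norm_mul _ ((Q ^ n) ^ k)]
    refine mul_le_of_le_one_right (norm_nonneg _) ?_
    rw [norm_pow, norm_pow]
    exact pow_le_one₀ (by positivity) (pow_le_one₀ (norm_nonneg _) hQ.le)

lemma summable_norm_pow_div_qpC (hQ : ‖Q‖ < 1) (hx : ‖x‖ < 1) :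
    Summable fun n : ℕ ↦ ‖(qpC Q Q n)⁻¹ * x ^ n‖ := by
  refine summable_norm_of_succ_eq_mul (ρ := fun n ↦ x * (1 - Q * Q ^ n)⁻¹) hx ?_ fun n ↦ ?_
  · simpa using (tendsto_one_sub_pow_succ_inv hQ).const_mul x
  · rw [qpC_succ, mul_inv]
    ring

/-- Euler's first identity: `∑ xⁿ / (Q;Q)_n = 1 / (x;Q)_∞`. -/
lemma qpInfC_mul_tsum (hQ : ‖Q‖ < 1) (hx : ‖x‖ < 1) :
    qpInfC Q x * ∑' n : ℕ, (qpC Q Q n)⁻¹ * x ^ n = 1 := by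
  have hsum : ∀ n, Summable fun k : ℕ ↦ (qpC Q Q k)⁻¹ * (x * Q ^ n) ^ k := fun n ↦ by
    refine (summable_norm_pow_div_qpC hQ ?_).of_norm
    rw [norm_mul, norm_pow]
    exact mul_lt_one_of_nonneg_of_lt_one_left (norm_nonneg _) hx
      (pow_le_one₀ (norm_nonneg _) hQ.le)
  have hstep : ∀ n, (1 - x * Q ^ n) * ∑' k : ℕ, (qpC Q Q k)⁻¹ * (x * Q ^ n) ^ k =
      ∑' k : ℕ, (qpC Q Q k)⁻¹ * (x * Q ^ (n + 1)) ^ k := by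
    intro n
    rw [(hsum (n + 1)).tsum_eq_zero_add, sub_mul, one_mul]
    nth_rewrite 1 [(hsum n).tsum_eq_zero_add]
    rw [← tsum_mul_left, pow_zero, pow_zero, add_sub_assoc,
      ← ((summable_nat_add_iff 1).2 (hsum n)).tsum_sub ((hsum n).mul_left _)]
    congr 1
    refine tsum_congr fun k ↦ ?_
    have h1 := qpC_self_ne_zero hQ k
    have h2 := one_sub_pow_succ_ne_zero hQ k
    rw [qpC_succ]
    field_simp
    ring
  have hiter : ∀ n, qpC Q x n * ∑' k : ℕ, (qpC Q Q k)⁻¹ * x ^ k =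
      ∑' k : ℕ, (qpC Q Q k)⁻¹ * (x * Q ^ n) ^ k := by
    intro n
    induction n with
    | zero => simp [qpC]
    | succ n ih => rw [← hstep, ← ih, qpC_succ]; ring
  refine tendsto_nhds_unique (((tendsto_qpC hQ x).mul_const _).congr hiter) ?_
  simpa [qpC] using tendsto_tsum_mul_pow hQ (summable_norm_pow_div_qpC hQ hx)

lemma qpInfC_ne_zero (hQ : ‖Q‖ < 1) (hx : ‖x‖ < 1) : qpInfC Q x ≠ 0 :=
  left_ne_zero_of_mul_eq_one (qpInfC_mul_tsum hQ hx)

/-- The coefficients `(-1)^k Q^{k(k-1)/2} / (Q;Q)_k` of the q-exponential series. -/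
noncomputable def qExpCoeff (Q : ℂ) (k : ℕ) : ℂ := (-1) ^ k * Q ^ k.choose 2 / qpC Q Q k

lemma qExpCoeff_zero (Q : ℂ) : qExpCoeff Q 0 = 1 := by simp [qExpCoeff, qpC]

lemma qExpCoeff_succ (Q : ℂ) (k : ℕ) :
    qExpCoeff Q (k + 1) = qExpCoeff Q k * (-Q ^ k * (1 - Q * Q ^ k)⁻¹) := by
  rw [qExpCoeff, qExpCoeff, qpC_succ, Nat.choose_succ_succ' k 1, Nat.choose_one_right, pow_add,
    div_eq_mul_inv, mul_inv]
  ring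

lemma summable_norm_qExpCoeff (hQ : ‖Q‖ < 1) (x : ℂ) :
    Summable fun k : ℕ ↦ ‖qExpCoeff Q k * x ^ k‖ := by
  refine summable_norm_of_succ_eq_mul (l := 0)
    (ρ := fun n ↦ -Q ^ n * (1 - Q * Q ^ n)⁻¹ * x) (by simp) ?_ fun n ↦ ?_
  · simpa using ((tendsto_pow_atTop_nhds_zero_of_norm_lt_one hQ).neg.mul
      (tendsto_one_sub_pow_succ_inv hQ)).mul_const x
  · rw [qExpCoeff_succ]
    ring

/-- Euler's second identity: `∑ (-1)^k Q^{k(k-1)/2} x^k / (Q;Q)_k = (x;Q)_∞`. -/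
lemma tsum_qExpCoeff (hQ : ‖Q‖ < 1) (x : ℂ) :
    ∑' k : ℕ, qExpCoeff Q k * x ^ k = qpInfC Q x := by
  have hsum : ∀ y, Summable fun k : ℕ ↦ qExpCoeff Q k * y ^ k :=
    fun y ↦ (summable_norm_qExpCoeff hQ y).of_norm
  have hstep : ∀ y, ∑' k : ℕ, qExpCoeff Q k * y ^ k =
      (1 - y) * ∑' k : ℕ, qExpCoeff Q k * (y * Q) ^ k := by
    intro y
    rw [(hsum y).tsum_eq_zero_add, sub_mul, one_mul]
    nth_rewrite 1 [(hsum (y * Q)).tsum_eq_zero_add]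
    rw [← tsum_mul_left, pow_zero, pow_zero, add_sub_assoc,
      ← ((summable_nat_add_iff 1).2 (hsum (y * Q))).tsum_sub ((hsum (y * Q)).mul_left _)]
    congr 1
    refine tsum_congr fun k ↦ ?_
    have h2 := one_sub_pow_succ_ne_zero hQ k
    rw [qExpCoeff_succ]
    linear_combination -(qExpCoeff Q k * Q ^ k * y ^ (k + 1)) * mul_inv_cancel₀ h2
  have hiter : ∀ n, qpC Q x n * ∑' k : ℕ, qExpCoeff Q k * (x * Q ^ n) ^ k =
      ∑' k : ℕ, qExpCoeff Q k * x ^ k := by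
    intro n
    induction n with
    | zero => simp [qpC]
    | succ n ih => rw [← ih, hstep (x * Q ^ n), qpC_succ, pow_succ]; ring_nf
  have h := (tendsto_qpC hQ x).mul (tendsto_tsum_mul_pow hQ (summable_norm_qExpCoeff hQ x))
  simp_rw [hiter, qExpCoeff_zero, mul_one] at h
  exact tendsto_nhds_unique tendsto_const_nhds h

lemma exists_norm_qpInfC_mul_pow_le (hQ : ‖Q‖ < 1) (x : ℂ) :
    ∃ M, ∀ k : ℕ, ‖qpInfC Q (x * Q ^ k)‖ ≤ M := by
  have h := tendsto_tsum_mul_pow hQ (summable_norm_qExpCoeff hQ x)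
  simp_rw [tsum_qExpCoeff hQ] at h
  obtain ⟨M, hM⟩ := h.norm.bddAbove_range
  exact ⟨M, fun k ↦ hM ⟨k, rfl⟩⟩

/-- The `q`-Erdélyi sum with powers stripped: base `Q`, parameter `A = q^{2ν+2}`. -/
lemma tsum_tsum_qExpCoeff {A : ℂ} (hQ : ‖Q‖ < 1) (hA : ‖A‖ < 1) (x : ℂ) :
    ∑' p : ℕ, (qpC Q Q p)⁻¹ * A ^ p *
      ∑' k : ℕ, qExpCoeff Q k * (x * Q ^ p) ^ k * qpInfC Q (A * Q ^ k) = qpInfC Q x := by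
  obtain ⟨M, hM⟩ := exists_norm_qpInfC_mul_pow_le hQ A
  have hsum : Summable (Function.uncurry fun p k : ℕ ↦ (qpC Q Q p)⁻¹ * A ^ p *
      (qExpCoeff Q k * (x * Q ^ p) ^ k * qpInfC Q (A * Q ^ k))) := by
    refine Summable.of_norm_bounded (((summable_norm_pow_div_qpC hQ hA).mul_of_nonneg
      (summable_norm_qExpCoeff hQ x) (fun _ ↦ norm_nonneg _)
      (fun _ ↦ norm_nonneg _)).mul_right M) ?_
    rintro ⟨p, k⟩
    have hpk : ‖(Q ^ p) ^ k‖ ≤ 1 := by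
      rw [norm_pow, norm_pow]
      exact pow_le_one₀ (by positivity) (pow_le_one₀ (norm_nonneg _) hQ.le)
    simp only [Function.uncurry_apply_pair]
    rw [mul_pow, ← mul_assoc, ← mul_assoc (qExpCoeff Q k), norm_mul, norm_mul,
      norm_mul _ ((Q ^ p) ^ k)]
    gcongr
    · exact mul_le_of_le_one_right (norm_nonneg _) hpk
    · exact hM k
  simp_rw [← tsum_mul_left]
  rw [← hsum.tsum_comm, ← tsum_qExpCoeff hQ x]
  refine tsum_congr fun k ↦ ?_
  have hAk : ‖A * Q ^ k‖ < 1 := by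
    rw [norm_mul, norm_pow]
    exact mul_lt_one_of_nonneg_of_lt_one_left (norm_nonneg _) hA
      (pow_le_one₀ (norm_nonneg _) hQ.le)
  rw [← mul_one (qExpCoeff Q k * x ^ k), ← qpInfC_mul_tsum hQ hAk, ← tsum_mul_left,
    ← tsum_mul_left]
  refine tsum_congr fun p ↦ ?_
  rw [mul_pow, mul_pow, ← pow_mul, ← pow_mul, mul_comm p k]
  ring

end QSeries

lemma sq_pow_choose_two (q : ℂ) (k : ℕ) : (q ^ 2) ^ k.choose 2 = q ^ (k * (k - 1)) := by
  rw [← pow_mul, Nat.choose_two_right, Nat.mul_div_cancel' (Nat.even_mul_pred_self k).two_dvd]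

lemma mul_ofReal_pow_cpow {q : ℝ} (hq : 0 < q) (z ν : ℂ) (p : ℕ) :
    (z * (q : ℂ) ^ p) ^ ν = z ^ ν * (q : ℂ) ^ ((p : ℂ) * ν) := by
  have hq' : (q : ℂ) ≠ 0 := by exact_mod_cast hq.ne'
  rcases eq_or_ne z 0 with rfl | hz
  · rcases eq_or_ne ν 0 with rfl | hν <;> simp [*]
  · rw [Complex.cpow_def_of_ne_zero (mul_ne_zero hz (pow_ne_zero _ hq')),
      Complex.cpow_def_of_ne_zero hz, Complex.cpow_def_of_ne_zero hq', mul_comm z,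
      ← Complex.ofReal_pow, Complex.log_ofReal_mul (pow_pos hq p) hz, Real.log_pow,
      ← Complex.ofReal_log hq.le, ← Complex.exp_add]
    push_cast
    ring_nf

/-- `Σ_{p≥0} q^{2p} q^{pν} (q^{2+2p};q²)_∞ J_ν(zq^p;q²) = z^ν (z²q²;q²)_∞`. -/
theorem qErdelyi_case_zero (q : ℝ) (hq0 : 0 < q) (hq1 : q < 1) (ν z : ℂ)
    (hν : -1 < ν.re) (hz : |z.arg| < Real.pi) :
    ∑' p : ℕ, (q : ℂ) ^ (2 * p) * (q : ℂ) ^ ((p : ℂ) * ν) *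
        qpInfC ((q : ℂ) ^ 2) ((q : ℂ) ^ (2 + 2 * p)) * JC q ν (z * (q : ℂ) ^ p) =
      z ^ ν * qpInfC ((q : ℂ) ^ 2) (z ^ 2 * (q : ℂ) ^ 2) := by
  have hq : (q : ℂ) ≠ 0 := by exact_mod_cast hq0.ne'
  have hQ : ‖(q : ℂ) ^ 2‖ < 1 := by
    rw [norm_pow, Complex.norm_of_nonneg hq0.le]
    exact pow_lt_one₀ hq0.le hq1 two_ne_zero
  have hA : ‖(q : ℂ) ^ (2 * ν + 2)‖ < 1 := by
    rw [Complex.norm_cpow_eq_rpow_re_of_pos hq0]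
    refine Real.rpow_lt_one hq0.le hq1 ?_
    simp
    linarith
  rw [← tsum_tsum_qExpCoeff hQ hA, ← tsum_mul_left]
  refine tsum_congr fun p ↦ ?_
  have hJ : ∑' k : ℕ, (-1) ^ k * (q : ℂ) ^ (k * (k - 1)) *
      ((q : ℂ) ^ 2 * (z * (q : ℂ) ^ p) ^ 2) ^ k *
      qpInfC ((q : ℂ) ^ 2) ((q : ℂ) ^ (2 * ν + 2 + 2 * (k : ℂ))) /
        qpC ((q : ℂ) ^ 2) ((q : ℂ) ^ 2) k =
      ∑' k : ℕ, qExpCoeff ((q : ℂ) ^ 2) k * (z ^ 2 * (q : ℂ) ^ 2 * ((q : ℂ) ^ 2) ^ p) ^ k *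
        qpInfC ((q : ℂ) ^ 2) ((q : ℂ) ^ (2 * ν + 2) * ((q : ℂ) ^ 2) ^ k) := by
    refine tsum_congr fun k ↦ ?_
    have hAk : (q : ℂ) ^ (2 * ν + 2 + 2 * (k : ℂ)) =
        (q : ℂ) ^ (2 * ν + 2) * ((q : ℂ) ^ 2) ^ k := by
      rw [Complex.cpow_add _ _ hq, ← pow_mul, ← Complex.cpow_natCast _ (2 * k)]
      push_cast
      rfl
    rw [hAk, qExpCoeff, sq_pow_choose_two]
    ring
  have hAp : ((q : ℂ) ^ (2 * ν + 2)) ^ p =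
      (q : ℂ) ^ (2 * p) * (q : ℂ) ^ ((p : ℂ) * ν) * (q : ℂ) ^ ((p : ℂ) * ν) := by
    rw [← Complex.cpow_nat_mul, ← Complex.cpow_natCast _ (2 * p), ← Complex.cpow_add _ _ hq,
      ← Complex.cpow_add _ _ hq]
    push_cast
    ring_nf
  have hsplit := qpC_mul_qpInfC hQ ((q : ℂ) ^ 2) p
  rw [← pow_mul, ← pow_add] at hsplit
  have hinf := qpInfC_ne_zero hQ hQ
  have hfin := qpC_self_ne_zero hQ p
  rw [JC, hJ, mul_ofReal_pow_cpow hq0, hAp]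
  rw [← hsplit] at hinf ⊢
  have hinf' := right_ne_zero_of_mul hinf
  field_simp
end
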